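/- Let G be a finite group acting on a smooth affine variety Spec A over ℂ with quotient Spec R, R = A^G, and suppose ω_A ≅ A ⊗_R ω_R as G-equivariant modules (equivariant local triviality of the dualizing module). Then for every G-equivariant finitely generated A-module M and every finitely generated projective R-module F, there is a natural isomorphism Hom_R(M^G, F) ≅ (Hom_A(M, A ⊗_R F))^G. -/

import Mathlib

/-- The subalgebra of `G`-invariants of a commutative `ℂ`-algebra `A` with `G`-action. -/
def fixedSubalgebra (G A : Type) [Group G] [CommRing A] [Algebra ℂ A]
    [MulSemiringAction G A] [SMulCommClass G ℂ A] : Subalgebra ℂ A where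
  carrier := {a | ∀ g : G, g • a = a}
  mul_mem' := fun ha hb g => by rw [smul_mul', ha g, hb g]
  add_mem' := fun ha hb g => by rw [smul_add, ha g, hb g]
  algebraMap_mem' := fun c g => by
    rw [Algebra.algebraMap_eq_smul_one, smul_comm, smul_one]

section

variable (G A : Type) [Group G] [CommRing A] [Algebra ℂ A]
  [MulSemiringAction G A] [SMulCommClass G ℂ A]

/-- The action of `g : G` on `A` as a linear map over the invariant subring `R = A^G`. -/
def fixedSubalgebra.actionMap (g : G) : A →ₗ[fixedSubalgebra G A] A where
  toFun a := g • a
  map_add' a b := smul_add g a b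
  map_smul' r a := by
    show g • (r • a) = r • (g • a)
    rw [Algebra.smul_def, Algebra.smul_def, smul_mul']
    congr 1
    exact r.2 g

variable (M : Type) [AddCommGroup M] [Module A M] [DistribMulAction G M]

/-- The `G`-invariants `M^G` of a `G`-equivariant `A`-module `M`, as a module over the
invariant subring `R = A^G`. -/
def invariantsSubmodule
    (hsemi : ∀ (g : G) (a : A) (m : M), g • (a • m) = (g • a) • (g • m)) :
    Submodule (fixedSubalgebra G A) M where
  carrier := {m | ∀ g : G, g • m = m}
  add_mem' := fun ha hb g => by rw [smul_add, ha g, hb g]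
  zero_mem' := fun g => smul_zero g
  smul_mem' := by
    intro r m hm g
    show g • ((r : A) • m) = (r : A) • m
    rw [hsemi, r.2 g, hm g]

variable (F : Type) [AddCommGroup F] [Module (fixedSubalgebra G A) F]

/-- The `G`-invariant part `(Hom_A(M, A ⊗_R F))^G` of the equivariant hom module: `A`-linear
maps `φ : M → A ⊗_R F` satisfying `φ(g • m) = (g ⊗ 1)(φ m)`. -/
def equivariantHomSubmodule :
    Submodule (fixedSubalgebra G A) (M →ₗ[A] TensorProduct (fixedSubalgebra G A) A F) where
  carrier := {φ | ∀ (g : G) (m : M),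
    φ (g • m) = TensorProduct.map (fixedSubalgebra.actionMap G A g) LinearMap.id (φ m)}
  add_mem' := by
    intro φ ψ hφ hψ g m
    simp only [LinearMap.add_apply, hφ g m, hψ g m, map_add]
  zero_mem' := by
    intro g m
    simp
  smul_mem' := by
    intro r φ hφ g m
    have h1 : (r • φ) (g • m) = (r : A) • φ (g • m) := rfl
    have h2 : (r • φ) m = (r : A) • φ m := rfl
    have h3 : ∀ x : TensorProduct (fixedSubalgebra G A) A F, (r : A) • x = r • x :=
      fun x => algebraMap_smul A r x
    show (r • φ) (g • m) = _
    rw [h1, h2, hφ g m, h3, h3, map_smul]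

end

section Helpers
open TensorProduct

variable {R A F : Type} [CommRing R] [CommRing A] [Algebra R A] [AddCommGroup F] [Module R F]

/-- The trace contraction `A ⊗ F → F`. -/
noncomputable def traceContr (θ : A →ₗ[R] R) : A ⊗[R] F →ₗ[R] F :=
  (TensorProduct.lid R F).toLinearMap ∘ₗ TensorProduct.map θ LinearMap.id

theorem traceContr_tmul (θ : A →ₗ[R] R) (a : A) (f : F) :
    traceContr θ (a ⊗ₜ[R] f) = θ a • f := by
  simp [traceContr]

theorem exists_dualBasis_aux [Module.Finite R F] [Module.Projective R F] :
    ∃ (n : ℕ) (v : Fin n → F) (c : Fin n → (F →ₗ[R] R)), ∀ f, ∑ i, c i f • v i = f := by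
  obtain ⟨n, p, s, -, -, hps⟩ := Module.Finite.exists_comp_eq_id_of_projective R F
  refine ⟨n, fun i => p (Pi.single i 1), fun i => LinearMap.proj i ∘ₗ s, fun f => ?_⟩
  have h := LinearMap.congr_fun hps f
  simp only [LinearMap.comp_apply, LinearMap.id_apply] at h
  conv_rhs => rw [← h, ← Finset.univ_sum_single (s f)]
  rw [map_sum]
  refine Finset.sum_congr rfl fun i _ => ?_
  rw [LinearMap.comp_apply, LinearMap.proj_apply, ← map_smul]
  congr 1
  ext j
  by_cases hj : j = i
  · subst hj; simp
  · simp [Pi.single_apply, hj]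

theorem traceContr_surj [Module.Finite R F] [Module.Projective R F] (θ : A →ₗ[R] R)
    (hθ : Function.Bijective fun a : A => θ ∘ₗ LinearMap.mul R A a) (h : A →ₗ[R] F) :
    ∃ x : A ⊗[R] F, ∀ b : A, traceContr θ (b • x) = h b := by
  obtain ⟨n, v, c, hvc⟩ := exists_dualBasis_aux (R := R) (F := F)
  choose a ha using fun i => hθ.2 (c i ∘ₗ h)
  refine ⟨∑ i, a i ⊗ₜ[R] v i, fun b => ?_⟩
  rw [Finset.smul_sum, map_sum]
  conv_rhs => rw [← hvc (h b)]
  refine Finset.sum_congr rfl fun i _ => ?_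
  rw [TensorProduct.smul_tmul', traceContr_tmul]
  have := LinearMap.congr_fun (ha i) b
  simp only [LinearMap.comp_apply, LinearMap.mul_apply'] at this
  rw [smul_eq_mul, mul_comm, this]

theorem traceContr_inj [Module.Finite R F] [Module.Projective R F] (θ : A →ₗ[R] R)
    (hθ : Function.Bijective fun a : A => θ ∘ₗ LinearMap.mul R A a) (x : A ⊗[R] F)
    (hx : ∀ b : A, traceContr θ (b • x) = 0) : x = 0 := by
  obtain ⟨n, v, c, hvc⟩ := exists_dualBasis_aux (R := R) (F := F)
  let k : Fin n → (A ⊗[R] F →ₗ[R] A) := fun i =>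
    (TensorProduct.rid R A).toLinearMap ∘ₗ TensorProduct.map LinearMap.id (c i)
  have hk : ∀ i a f, k i (a ⊗ₜ[R] f) = c i f • a := fun i a f => by simp [k]
  have h1 : ∀ y : A ⊗[R] F, ∑ i, k i y ⊗ₜ[R] v i = y := by
    intro y
    induction y with
    | zero => simp
    | add y z hy hz =>
      conv_rhs => rw [← hy, ← hz]
      rw [← Finset.sum_add_distrib]
      simp only [map_add, TensorProduct.add_tmul]
    | tmul a f =>
      conv_rhs => rw [← hvc f]
      simp only [hk, TensorProduct.tmul_sum, TensorProduct.smul_tmul]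
  have h2 : ∀ i (b : A) (y : A ⊗[R] F), θ (k i y * b) = c i (traceContr θ (b • y)) := by
    intro i b y
    induction y with
    | zero => simp
    | add y z hy hz => simp only [map_add, add_mul, smul_add, hy, hz]
    | tmul a f =>
      rw [hk, TensorProduct.smul_tmul', traceContr_tmul, smul_mul_assoc, map_smul, map_smul,
        smul_eq_mul, smul_eq_mul, smul_eq_mul, mul_comm, mul_comm a b]
  have h3 : ∀ i, k i x = 0 := by
    intro i
    apply hθ.1
    ext b
    simp [h2, hx]
  rw [← h1 x]
  simp [h3]

end Helpers

/-- Let `G` be a finite group acting on a smooth affine variety `Spec A` over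
`ℂ` with quotient `Spec R`, `R = A^G`, and suppose `ω_A ≅ A ⊗_R ω_R` as `G`-equivariant
modules (equivariant local triviality of the dualizing module); equivalently, the relative
dualizing module `ω_{A/R} = Hom_R(A, R)` of `R → A` is `G`-equivariantly trivial, which we
formalize as the existence of a `G`-invariant trace form `θ : A → R` for which `a ↦ θ(a·–)` is
an isomorphism `A ≅ Hom_R(A, R)`. Then for every `G`-equivariant finitely generated `A`-module
`M` and every finitely generated projective `R`-module `F`, there is a natural isomorphism
`Hom_R(M^G, F) ≅ (Hom_A(M, A ⊗_R F))^G`. -/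
theorem statement17
    (G : Type) [Group G] [Fintype G]
    (A : Type) [CommRing A] [Algebra ℂ A] [MulSemiringAction G A] [SMulCommClass G ℂ A]
    [Algebra.Smooth ℂ A]
    (θ : A →ₗ[fixedSubalgebra G A] fixedSubalgebra G A)
    (hθG : ∀ (g : G) (a : A), θ (g • a) = θ a)
    (hθdual : Function.Bijective fun a : A => θ ∘ₗ LinearMap.mul (fixedSubalgebra G A) A a)
    (M : Type) [AddCommGroup M] [Module A M] [DistribMulAction G M] [Module.Finite A M]
    (hsemi : ∀ (g : G) (a : A) (m : M), g • (a • m) = (g • a) • (g • m))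
    (F : Type) [AddCommGroup F] [Module (fixedSubalgebra G A) F]
    [Module.Finite (fixedSubalgebra G A) F] [Module.Projective (fixedSubalgebra G A) F] :
    Nonempty ((invariantsSubmodule G A M hsemi →ₗ[fixedSubalgebra G A] F) ≃ₗ[fixedSubalgebra G A]
      equivariantHomSubmodule G A M F) := by
  classical
  -- |G|⁻¹ in the invariant ring
  have hcard : ((Fintype.card G : ℕ) : ℂ) ≠ 0 := by
    exact_mod_cast Fintype.card_ne_zero
  let u : fixedSubalgebra G A := algebraMap ℂ _ ((Fintype.card G : ℂ)⁻¹)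
  have hu : u * (Fintype.card G : fixedSubalgebra G A) = 1 := by
    have h : ((Fintype.card G : ℕ) : fixedSubalgebra G A)
        = algebraMap ℂ (fixedSubalgebra G A) (Fintype.card G : ℂ) := by simp
    rw [h, ← map_mul, inv_mul_cancel₀ hcard, map_one]
  -- G acts R-linearly on M
  have hGR : ∀ (g : G) (r : fixedSubalgebra G A) (m : M), g • (r • m) = r • (g • m) := by
    intro g r m
    show g • ((r : A) • m) = (r : A) • (g • m)
    rw [hsemi, r.2 g]
  let av : M →ₗ[fixedSubalgebra G A] invariantsSubmodule G A M hsemi :=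
    { toFun := fun m => ⟨u • ∑ g : G, g • m, by
        intro h
        rw [hGR, Finset.smul_sum]
        congr 1
        simp only [smul_smul]
        exact Fintype.sum_equiv (Equiv.mulLeft h) _ _ (fun _ => rfl)⟩
      map_add' := fun x y => by
        ext
        simp [smul_add, Finset.sum_add_distrib]
      map_smul' := fun r x => by
        ext
        simp only [hGR, ← Finset.smul_sum, RingHom.id_apply, Submodule.coe_smul]
        rw [smul_comm] }
  have hav : ∀ m, ((av m : invariantsSubmodule G A M hsemi) : M) = u • ∑ g : G, g • m :=
    fun _ => rfl
  have hu' : ∀ {N : Type} [AddCommGroup N] [Module (fixedSubalgebra G A) N] (y : N),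
      u • ∑ _g : G, y = y := by
    intro N _ _ y
    rw [Finset.sum_const, Finset.card_univ, ← Nat.cast_smul_eq_nsmul (fixedSubalgebra G A),
      smul_smul, hu, one_smul]
  have hav_inv : ∀ m : invariantsSubmodule G A M hsemi, av (m : M) = m := by
    intro m
    ext
    rw [hav, Finset.sum_congr rfl (fun g _ => m.2 g)]
    exact hu' _
  have hav_g : ∀ (g : G) (m : M), av (g • m) = av m := by
    intro g m
    ext
    rw [hav, hav]
    congr 1
    simp only [smul_smul]
    exact Fintype.sum_equiv (Equiv.mulRight g) _ _ (fun _ => rfl)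
  let T : TensorProduct (fixedSubalgebra G A) A F →ₗ[fixedSubalgebra G A] F := traceContr θ
  let act : G → TensorProduct (fixedSubalgebra G A) A F →ₗ[fixedSubalgebra G A]
      TensorProduct (fixedSubalgebra G A) A F := fun g =>
    TensorProduct.map (fixedSubalgebra.actionMap G A g) LinearMap.id
  have hTact : ∀ g x, T (act g x) = T x := by
    intro g x
    induction x with
    | zero => simp
    | add y z hy hz => rw [map_add, map_add, map_add, hy, hz]
    | tmul a f =>
      show traceContr θ ((g • a) ⊗ₜ f) = traceContr θ (a ⊗ₜ f)
      rw [traceContr_tmul, traceContr_tmul, hθG]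
  have hact_smul : ∀ g (b : A) x, act g (b • x) = (g • b) • act g x := by
    intro g b x
    induction x with
    | zero => simp
    | add y z hy hz => rw [smul_add, map_add, map_add, hy, hz, smul_add]
    | tmul a f =>
      show (g • (b * a)) ⊗ₜ f = ((g • b) * (g • a)) ⊗ₜ f
      rw [smul_mul']
  have hinj : ∀ x y : TensorProduct (fixedSubalgebra G A) A F,
      (∀ b : A, T (b • x) = T (b • y)) → x = y := by
    intro x y h
    rw [← sub_eq_zero]
    refine traceContr_inj θ hθdual _ fun b => ?_
    rw [smul_sub, map_sub, sub_eq_zero]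
    exact h b
  let Φ : equivariantHomSubmodule G A M F →ₗ[fixedSubalgebra G A]
      (invariantsSubmodule G A M hsemi →ₗ[fixedSubalgebra G A] F) :=
    { toFun := fun φ =>
        { toFun := fun m => T (φ.1 (m : M))
          map_add' := fun x y => by
            rw [Submodule.coe_add, map_add, map_add]
          map_smul' := fun r x => by
            have h1 : φ.1 (((r • x : invariantsSubmodule G A M hsemi)) : M)
                = r • φ.1 (x : M) := by
              rw [← algebraMap_smul A r (φ.1 (x : M)), ← map_smul]
              rfl
            rw [h1, map_smul]
            rfl }
      map_add' := fun φ ψ => by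
        ext m
        show T (φ.1 m + ψ.1 m) = T (φ.1 m) + T (ψ.1 m)
        rw [map_add]
      map_smul' := fun r φ => by
        ext m
        show T ((r : A) • φ.1 m) = r • T (φ.1 m)
        have h3 : (r : A) • φ.1 (m : M) = r • φ.1 (m : M) := algebraMap_smul A r _
        rw [h3, LinearMap.map_smul T] }
  have hΦ : ∀ φ m, Φ φ m = T (φ.1 (m : M)) := fun _ _ => rfl
  refine ⟨(LinearEquiv.ofBijective Φ ⟨?_, ?_⟩).symm⟩
  · have hTφ : ∀ (φ : equivariantHomSubmodule G A M F) (m : M),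
        T (φ.1 m) = Φ φ (av m) := by
      intro φ m
      have h1 : ∀ g : G, T (φ.1 (g • m)) = T (φ.1 m) := fun g => by
        rw [φ.2 g m]
        exact hTact g _
      have h3 : φ.1 (u • ∑ g : G, g • m) = u • φ.1 (∑ g : G, g • m) := by
        rw [← algebraMap_smul A u (φ.1 _), ← map_smul]
        rfl
      rw [hΦ, hav, h3, map_smul, map_sum, map_sum, Finset.sum_congr rfl (fun g _ => h1 g), hu']
    intro φ ψ hφψ
    apply Subtype.ext
    apply LinearMap.ext
    intro m
    apply hinj
    intro b
    rw [← map_smul, ← map_smul, hTφ, hTφ, hφψ]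
  · intro f
    choose X hX using fun m : M => traceContr_surj θ hθdual
      ((f ∘ₗ av) ∘ₗ ((LinearMap.toSpanSingleton A M m).restrictScalars (fixedSubalgebra G A)))
    have hX' : ∀ m b, T (b • X m) = f (av (b • m)) := hX
    let φ : M →ₗ[A] TensorProduct (fixedSubalgebra G A) A F :=
      { toFun := X
        map_add' := fun x y => hinj _ _ fun b => by
          rw [smul_add, map_add, hX', hX', hX', smul_add, map_add, map_add]
        map_smul' := fun a x => hinj _ _ fun b => by
          rw [RingHom.id_apply, smul_smul, hX', hX', smul_smul] }
    refine ⟨⟨φ, ?_⟩, ?_⟩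
    · intro g m
      show X (g • m) = act g (X m)
      apply hinj
      intro b
      have hb : b = g • (g⁻¹ • b) := by rw [smul_inv_smul]
      rw [hX']
      conv_rhs => rw [hb, ← hact_smul, hTact, hX']
      conv_lhs => rw [hb, ← hsemi, hav_g]
    · ext m
      rw [hΦ]
      show T (X m) = f m
      have := hX' m 1
      rw [one_smul, one_smul, hav_inv] at this
      exact this
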